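/- (Logarithmic divergence of the diagonal.) There exist constants K₁, K₂ > 0 such that for every m ∈ (0,1), every L ∈ ℕ and every site j of the torus Λ = (ℤ/Lℤ)², one has (C_m^Λ)_{jj} ≥ (C_m^∞)_{jj} ≥ K₁ ln(1/m) + K₂, where (C_m^∞)_{xy} is the lattice Green's function of −Δ + m² on ℤ². -/

import Mathlib

open MeasureTheory Matrix Filter Set ProbabilityTheory

noncomputable section

/-- Sites of the `d`-dimensional discrete torus `Λ = (ℤ/Lℤ)^d`. -/
abbrev Site (d L : ℕ) := Fin d → ZMod L

/-- The negative discrete Laplacian `−Δ` with periodic boundary conditions, as a matrix: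
`(x, −Δ x) = Σ_{i∼j} (x_i − x_j)²`. -/
def negLap (d L : ℕ) [NeZero L] : Matrix (Site d L) (Site d L) ℝ :=
  fun i j => (if i = j then (2 * d : ℝ) else 0)
    - ∑ k : Fin d, ((if j = Function.update i k (i k + 1) then (1 : ℝ) else 0)
        + (if j = Function.update i k (i k - 1) then (1 : ℝ) else 0))

/-- The finite-volume lattice Green's function `C_m^Λ = (−Δ_Λ^P + m²)⁻¹`. -/
def CmLat (L : ℕ) [NeZero L] (m : ℝ) : Matrix (Site 2 L) (Site 2 L) ℝ :=
  (negLap 2 L + m ^ 2 • 1)⁻¹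

/-- The periodic (torus) Euclidean distance between two sites of `(ℤ/Lℤ)²`: the infimum of the
Euclidean norms of the integer representatives of `i − j`. -/
def torusDist (L : ℕ) [NeZero L] (i j : Site 2 L) : ℝ :=
  sInf {r : ℝ | ∃ x : Fin 2 → ℤ, (∀ k, ((x k : ZMod L)) = i k - j k) ∧
    r = Real.sqrt (∑ k, ((x k : ℝ)) ^ 2)}

/-- The infinite-volume lattice Green's function of `−Δ + m²` on `ℤ²`,
`(C_m^∞)_{xy} = (2π)^{−2} ∫_{[−π,π]²} e^{i k·(x−y)} / (2Σ_l (1 − cos k_l) + m²) d²k`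
(a real number: the imaginary part of the integral vanishes). -/
def Cinf (m : ℝ) (x y : ℤ × ℤ) : ℝ :=
  ((2 * Real.pi) ^ 2)⁻¹ *
    (∫ k in Set.Icc (-Real.pi) Real.pi ×ˢ Set.Icc (-Real.pi) Real.pi,
      Complex.exp (Complex.I * ((k.1 : ℂ) * (((x.1 - y.1 : ℤ)) : ℂ)
          + (k.2 : ℂ) * (((x.2 - y.2 : ℤ)) : ℂ))) /
        (((2 * ((1 - Real.cos k.1) + (1 - Real.cos k.2)) + m ^ 2 : ℝ)) : ℂ)).re

/-- The representative of a torus site in `{0,…,L−1}² ⊂ ℤ²`. -/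
def rep (L : ℕ) [NeZero L] (j : Site 2 L) : ℤ × ℤ := (((j 0).val : ℤ), ((j 1).val : ℤ))

/-- The Brillouin zone `[-π, π]²`. -/
def zone : Set (ℝ × ℝ) :=
  Set.Icc (-Real.pi) Real.pi ×ˢ Set.Icc (-Real.pi) Real.pi

/-- The Fourier symbol of the adjacency operator of `ℤ²`. -/
def hopSymbol (k : ℝ × ℝ) : ℝ := 2 * Real.cos k.1 + 2 * Real.cos k.2

/-- The Fourier representation of the number of walks of length `n` in `ℤ²` from the origin to
`(p, q)`. -/
def walkCount (n : ℕ) (p q : ℤ) : ℝ :=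
  ((2 * Real.pi) ^ 2)⁻¹ * ∫ k in zone, hopSymbol k ^ n * Real.cos (k.1 * p + k.2 * q)

/-- The adjacency matrix of the two-dimensional torus, counting multiple edges. -/
def hopMatrix (L : ℕ) : Matrix (Site 2 L) (Site 2 L) ℝ :=
  fun i j => ∑ k : Fin 2, ((if j = Function.update i k (i k + 1) then (1 : ℝ) else 0)
    + (if j = Function.update i k (i k - 1) then (1 : ℝ) else 0))

lemma isCompact_zone : IsCompact zone := isCompact_Icc.prod isCompact_Icc

lemma integrableOn_zone {f : ℝ × ℝ → ℝ} (hf : Continuous f) : IntegrableOn f zone :=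
  hf.continuousOn.integrableOn_compact isCompact_zone

lemma continuous_hopSymbol : Continuous hopSymbol := by
  unfold hopSymbol; fun_prop

lemma abs_hopSymbol_le (k : ℝ × ℝ) : |hopSymbol k| ≤ 4 := by
  unfold hopSymbol
  rw [abs_le]
  constructor <;> linarith [Real.cos_le_one k.1, Real.cos_le_one k.2,
    Real.neg_one_le_cos k.1, Real.neg_one_le_cos k.2]

lemma setIntegral_cos_mul_int (p : ℤ) :
    ∫ x in Set.Icc (-Real.pi) Real.pi, Real.cos (x * p) = if p = 0 then 2 * Real.pi else 0 := by
  rw [integral_Icc_eq_integral_Ioc,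
    ← intervalIntegral.integral_of_le (by linarith [Real.pi_pos])]
  split_ifs with h
  · subst h
    simp
    ring
  · have hp : (p : ℝ) ≠ 0 := by exact_mod_cast h
    rw [intervalIntegral.integral_comp_mul_right _ hp, integral_cos]
    simp [mul_comm Real.pi, Real.sin_int_mul_pi]

lemma setIntegral_sin_mul_int (p : ℤ) :
    ∫ x in Set.Icc (-Real.pi) Real.pi, Real.sin (x * p) = 0 := by
  rw [integral_Icc_eq_integral_Ioc,
    ← intervalIntegral.integral_of_le (by linarith [Real.pi_pos])]
  by_cases h : p = 0
  · subst h
    simp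
  · have hp : (p : ℝ) ≠ 0 := by exact_mod_cast h
    rw [intervalIntegral.integral_comp_mul_right _ hp, integral_sin]
    simp

lemma walkCount_zero (p q : ℤ) : walkCount 0 p q = if p = 0 ∧ q = 0 then 1 else 0 := by
  have h : ∫ k in zone, Real.cos (k.1 * p + k.2 * q) =
      (if p = 0 then 2 * Real.pi else 0) * (if q = 0 then 2 * Real.pi else 0) := by
    simp only [Real.cos_add]
    rw [integral_sub (integrableOn_zone (by fun_prop)) (integrableOn_zone (by fun_prop))]
    unfold zone
    rw [Measure.volume_eq_prod,
      setIntegral_prod_mul (fun x => Real.cos (x * p)) (fun x => Real.cos (x * q)),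
      setIntegral_prod_mul (fun x => Real.sin (x * p)) (fun x => Real.sin (x * q)),
      setIntegral_cos_mul_int, setIntegral_cos_mul_int, setIntegral_sin_mul_int]
    ring
  unfold walkCount
  simp only [pow_zero, one_mul, h]
  have := Real.pi_ne_zero
  by_cases hp : p = 0 <;> by_cases hq : q = 0 <;> simp [hp, hq]
  field_simp

lemma walkCount_succ (n : ℕ) (p q : ℤ) :
    walkCount (n + 1) p q = walkCount n (p - 1) q + walkCount n (p + 1) q
      + (walkCount n p (q - 1) + walkCount n p (q + 1)) := by
  have hi (a b : ℤ) : IntegrableOn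
      (fun k : ℝ × ℝ => hopSymbol k ^ n * Real.cos (k.1 * a + k.2 * b)) zone :=
    integrableOn_zone ((continuous_hopSymbol.pow n).mul (by fun_prop))
  unfold walkCount
  rw [← mul_add, ← mul_add, ← mul_add, ← integral_add (hi _ _) (hi _ _),
    ← integral_add (hi _ _) (hi _ _),
    ← integral_add (by exact (hi _ _).add (hi _ _)) (by exact (hi _ _).add (hi _ _))]
  congr 2
  ext k
  have e1 : k.1 * ((p - 1 : ℤ) : ℝ) + k.2 * q = (k.1 * p + k.2 * q) - k.1 := by push_cast; ring
  have e2 : k.1 * ((p + 1 : ℤ) : ℝ) + k.2 * q = (k.1 * p + k.2 * q) + k.1 := by push_cast; ring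
  have e3 : k.1 * (p : ℝ) + k.2 * ((q - 1 : ℤ) : ℝ) = (k.1 * p + k.2 * q) - k.2 := by
    push_cast; ring
  have e4 : k.1 * (p : ℝ) + k.2 * ((q + 1 : ℤ) : ℝ) = (k.1 * p + k.2 * q) + k.2 := by
    push_cast; ring
  rw [e1, e2, e3, e4]
  generalize k.1 * (p : ℝ) + k.2 * q = θ
  rw [Real.cos_sub, Real.cos_add, Real.cos_sub, Real.cos_add, pow_succ]
  unfold hopSymbol
  ring

lemma hopMatrix_mul_apply {L : ℕ} [NeZero L] (M : Matrix (Site 2 L) (Site 2 L) ℝ)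
    (i j : Site 2 L) :
    (hopMatrix L * M) i j = M (Function.update i 0 (i 0 + 1)) j
      + M (Function.update i 0 (i 0 - 1)) j + (M (Function.update i 1 (i 1 + 1)) j
      + M (Function.update i 1 (i 1 - 1)) j) := by
  simp only [Matrix.mul_apply, hopMatrix, Fin.sum_univ_two, add_mul, Finset.sum_add_distrib,
    ite_mul, one_mul, zero_mul, Finset.sum_ite_eq', Finset.mem_univ, if_true]
  ring

/-- Walks in `ℤ²` project to walks on the torus. -/
lemma walkCount_le_hopMatrix_pow {L : ℕ} [NeZero L] (n : ℕ) (i j : Site 2 L) (p q : ℤ)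
    (hp : (p : ZMod L) = j 0 - i 0) (hq : (q : ZMod L) = j 1 - i 1) :
    walkCount n p q ≤ (hopMatrix L ^ n) i j := by
  induction n generalizing i p q with
  | zero =>
    rw [walkCount_zero, pow_zero, Matrix.one_apply]
    split_ifs with h1 h2
    · exact le_rfl
    · refine absurd ?_ h2
      obtain ⟨rfl, rfl⟩ := h1
      ext k
      fin_cases k
      · exact (sub_eq_zero.1 (by simpa using hp.symm)).symm
      · exact (sub_eq_zero.1 (by simpa using hq.symm)).symm
    · exact zero_le_one
    · exact le_rfl
  | succ n ih =>
    rw [walkCount_succ, pow_succ', hopMatrix_mul_apply]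
    gcongr <;> apply ih <;> simp [hp, hq] <;> ring

lemma negLap_add_smul_one (L : ℕ) [NeZero L] (m : ℝ) :
    negLap 2 L + m ^ 2 • (1 : Matrix (Site 2 L) (Site 2 L) ℝ)
      = (4 + m ^ 2) • (1 : Matrix (Site 2 L) (Site 2 L) ℝ) - hopMatrix L := by
  ext i j
  simp only [negLap, hopMatrix, Matrix.add_apply, Matrix.sub_apply, Matrix.smul_apply,
    Matrix.one_apply, smul_eq_mul]
  split_ifs <;> push_cast <;> ring

lemma hopMatrix_nonneg {L : ℕ} (i j : Site 2 L) : 0 ≤ hopMatrix L i j := by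
  unfold hopMatrix
  positivity

lemma hopMatrix_pow_nonneg {L : ℕ} [NeZero L] (n : ℕ) (i j : Site 2 L) :
    0 ≤ (hopMatrix L ^ n) i j := by
  induction n generalizing i with
  | zero =>
    rw [pow_zero, Matrix.one_apply]
    positivity
  | succ n ih =>
    rw [pow_succ', hopMatrix_mul_apply]
    linarith [ih (Function.update i 0 (i 0 + 1)), ih (Function.update i 0 (i 0 - 1)),
      ih (Function.update i 1 (i 1 + 1)), ih (Function.update i 1 (i 1 - 1))]

section NeumannSeries

attribute [local instance] Matrix.linftyOpNormedRing Matrix.linftyOpNormedAlgebra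

/-- The Neumann series of the torus Green's function. -/
lemma hasSum_CmLat_apply {L : ℕ} [NeZero L] {m : ℝ} (hm : 0 < m) (i j : Site 2 L) :
    HasSum (fun n : ℕ => ((4 + m ^ 2) ^ (n + 1))⁻¹ * (hopMatrix L ^ n) i j) (CmLat L m i j) := by
  have ha : 0 < 4 + m ^ 2 := by positivity
  set B : Matrix (Site 2 L) (Site 2 L) ℝ := (4 + m ^ 2)⁻¹ • hopMatrix L with hB
  have hA : ‖hopMatrix L‖ ≤ 4 := by
    rw [Matrix.linfty_opNorm_def]
    have : (Finset.univ : Finset (Site 2 L)).sup (fun i => ∑ j, ‖hopMatrix L i j‖₊) ≤ 4 := by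
      refine Finset.sup_le fun i _ => ?_
      rw [← NNReal.coe_le_coe]
      push_cast
      simp only [Real.norm_of_nonneg (hopMatrix_nonneg _ _)]
      simp only [hopMatrix, Fin.sum_univ_two, Finset.sum_add_distrib, Finset.sum_ite_eq',
        Finset.mem_univ, if_true]
      norm_num
    exact_mod_cast this
  have hB1 : ‖B‖ < 1 := by
    calc ‖B‖ ≤ ‖(4 + m ^ 2)⁻¹‖ * ‖hopMatrix L‖ := norm_smul_le _ _
      _ ≤ (4 + m ^ 2)⁻¹ * 4 := by
        rw [Real.norm_of_nonneg (by positivity)]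
        gcongr
      _ < 1 := by
        rw [inv_mul_lt_iff₀ ha]
        nlinarith
  have hs := summable_geometric_of_norm_lt_one hB1
  have hinv : CmLat L m = (4 + m ^ 2)⁻¹ • ∑' n : ℕ, B ^ n := by
    unfold CmLat
    apply Matrix.inv_eq_right_inv
    have hfac : negLap 2 L + m ^ 2 • (1 : Matrix (Site 2 L) (Site 2 L) ℝ)
        = (4 + m ^ 2) • (1 - B) := by
      rw [negLap_add_smul_one, hB, smul_sub, smul_smul, mul_inv_cancel₀ ha.ne', one_smul]
    rw [hfac, smul_mul_smul_comm, mul_inv_cancel₀ ha.ne', one_smul]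
    exact mul_neg_geom_series B hB1
  have h := Pi.hasSum.1 (Pi.hasSum.1 (hs.hasSum.const_smul (4 + m ^ 2)⁻¹) i) j
  have hterm (n : ℕ) : ((4 + m ^ 2) ^ (n + 1))⁻¹ * (hopMatrix L ^ n) i j
      = ((4 + m ^ 2)⁻¹ • B ^ n) i j := by
    rw [hB, smul_pow, smul_smul]
    simp [pow_succ, mul_comm]
  simp only [hterm, hinv]
  exact h

end NeumannSeries

lemma four_add_sq_sub_hopSymbol (m : ℝ) (k : ℝ × ℝ) :
    2 * ((1 - Real.cos k.1) + (1 - Real.cos k.2)) + m ^ 2 = 4 + m ^ 2 - hopSymbol k := by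
  unfold hopSymbol; ring

lemma four_add_sq_sub_hopSymbol_pos {m : ℝ} (hm : 0 < m) (k : ℝ × ℝ) :
    0 < 4 + m ^ 2 - hopSymbol k := by
  have := (abs_le.1 (abs_hopSymbol_le k)).2
  have : 0 < m ^ 2 := by positivity
  linarith

lemma Cinf_self (m : ℝ) (x : ℤ × ℤ) :
    Cinf m x x = ((2 * Real.pi) ^ 2)⁻¹ * ∫ k in zone, (4 + m ^ 2 - hopSymbol k)⁻¹ := by
  unfold Cinf
  simp only [four_add_sq_sub_hopSymbol]
  congr 1
  rw [← Complex.ofReal_re (∫ k in zone, (4 + m ^ 2 - hopSymbol k)⁻¹), ← integral_complex_ofReal]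
  simp [zone]

lemma continuous_resolventSymbol {m : ℝ} (hm : 0 < m) :
    Continuous fun k => (4 + m ^ 2 - hopSymbol k)⁻¹ :=
  (continuous_const.sub continuous_hopSymbol).inv₀
    fun k => (four_add_sq_sub_hopSymbol_pos hm k).ne'

lemma Cinf_self_le_CmLat_self {L : ℕ} [NeZero L] {m : ℝ} (hm : 0 < m) (x : ℤ × ℤ)
    (j : Site 2 L) : Cinf m x x ≤ CmLat L m j j := by
  have hm2 : 0 < m ^ 2 := by positivity
  set a : ℝ := 4 + m ^ 2 with ha_def
  have ha : 0 < a := by positivity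
  have hi := integrableOn_zone (continuous_resolventSymbol hm)
  have hbound (N : ℕ) : Cinf m x x ≤ CmLat L m j j + (4 / a) ^ N * Cinf m x x := by
    have hpt (k : ℝ × ℝ) : (a - hopSymbol k)⁻¹ ≤
        ∑ n ∈ Finset.range N, (a ^ (n + 1))⁻¹ * hopSymbol k ^ n
          + (4 / a) ^ N * (a - hopSymbol k)⁻¹ := by
      have hd : 0 < a - hopSymbol k := four_add_sq_sub_hopSymbol_pos hm k
      have hgeom : ∑ n ∈ Finset.range N, (a ^ (n + 1))⁻¹ * hopSymbol k ^ n
          = (1 - (hopSymbol k / a) ^ N) * (a - hopSymbol k)⁻¹ := by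
        rw [eq_mul_inv_iff_mul_eq₀ hd.ne', ← mul_neg_geom_sum, Finset.sum_mul, Finset.mul_sum]
        refine Finset.sum_congr rfl fun n _ => ?_
        rw [div_pow]
        field_simp
        ring
      have hpow : (hopSymbol k / a) ^ N ≤ (4 / a) ^ N := by
        refine (le_abs_self _).trans ?_
        rw [abs_pow, abs_div, abs_of_pos ha]
        gcongr
        exact abs_hopSymbol_le k
      rw [hgeom, ← add_mul]
      exact le_mul_of_one_le_left (inv_pos.2 hd).le (by linarith)
    have hin (n : ℕ) : IntegrableOn (fun k => (a ^ (n + 1))⁻¹ * hopSymbol k ^ n) zone :=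
      integrableOn_zone (continuous_const.mul (continuous_hopSymbol.pow n))
    have hint := integral_mono hi
      ((integrable_finsetSum (Finset.range N) fun n _ => hin n).add (hi.const_mul _)) hpt
    simp only [Pi.add_apply] at hint
    rw [integral_add (integrable_finsetSum (Finset.range N) fun n _ => hin n) (hi.const_mul _),
      integral_finsetSum _ fun n _ => hin n, integral_const_mul] at hint
    simp only [integral_const_mul] at hint
    have hsum : ∑ n ∈ Finset.range N, (a ^ (n + 1))⁻¹ * walkCount n 0 0 ≤ CmLat L m j j := by
      refine le_trans (Finset.sum_le_sum fun n _ => ?_)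
        (sum_le_hasSum (Finset.range N) (fun n _ => ?_) (hasSum_CmLat_apply hm j j))
      · gcongr
        exact walkCount_le_hopMatrix_pow n j j 0 0 (by simp) (by simp)
      · exact mul_nonneg (by positivity) (hopMatrix_pow_nonneg n j j)
    have hscaled := mul_le_mul_of_nonneg_left hint
      (show 0 ≤ ((2 * Real.pi) ^ 2)⁻¹ by positivity)
    rw [Cinf_self]
    refine hscaled.trans ?_
    rw [mul_add]
    refine add_le_add (le_trans (le_of_eq ?_) hsum) (le_of_eq (by ring))
    rw [Finset.mul_sum]
    refine Finset.sum_congr rfl fun n _ => ?_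
    simp only [walkCount, Int.cast_zero, mul_zero, add_zero, Real.cos_zero, mul_one]
    ring
  have hq : Tendsto (fun N : ℕ => CmLat L m j j + (4 / a) ^ N * Cinf m x x) atTop
      (nhds (CmLat L m j j + 0 * Cinf m x x)) :=
    ((tendsto_pow_atTop_nhds_zero_of_lt_one (by positivity)
      (by rw [div_lt_one ha]; linarith)).mul_const _).const_add _
  simpa using ge_of_tendsto' hq hbound

lemma integral_div_two_mul_sq_add {m : ℝ} (hm : 0 < m) :
    ∫ x in (0 : ℝ)..Real.pi, x / (2 * x ^ 2 + m ^ 2)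
      = 1 / 4 * (Real.log (2 * Real.pi ^ 2 + m ^ 2) - Real.log (m ^ 2)) := by
  have hd (x : ℝ) : 2 * x ^ 2 + m ^ 2 ≠ 0 := by positivity
  have hderiv (x : ℝ) : HasDerivAt (fun x : ℝ => 1 / 4 * Real.log (2 * x ^ 2 + m ^ 2))
      (x / (2 * x ^ 2 + m ^ 2)) x := by
    have h := ((((hasDerivAt_pow 2 x).const_mul 2).add_const (m ^ 2)).log (hd x)).const_mul
      (1 / 4 : ℝ)
    refine h.congr_deriv ?_
    push_cast
    ring
  rw [intervalIntegral.integral_eq_sub_of_hasDerivAt (fun x _ => hderiv x)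
    (Continuous.intervalIntegrable (continuous_id.div (by fun_prop) hd) _ _)]
  simp
  ring

lemma log_le_setIntegral_zone {m : ℝ} (hm : 0 < m) :
    1 / 2 * Real.log (1 / m) + 1 / 4 * Real.log (2 * Real.pi ^ 2)
      ≤ ∫ k in zone, (4 + m ^ 2 - hopSymbol k)⁻¹ := by
  have hpi := Real.pi_pos
  have hcont := continuous_resolventSymbol hm
  have hnonneg (k : ℝ × ℝ) : 0 ≤ (4 + m ^ 2 - hopSymbol k)⁻¹ :=
    (inv_pos.2 (four_add_sq_sub_hopSymbol_pos hm k)).le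
  have hi := integrableOn_zone hcont
  have hinner (x : ℝ) (hx : x ∈ Set.Icc 0 Real.pi) : x / (2 * x ^ 2 + m ^ 2) ≤
      ∫ y in Set.Icc (-Real.pi) Real.pi, (4 + m ^ 2 - hopSymbol (x, y))⁻¹ := by
    have hcx : Continuous fun y => (4 + m ^ 2 - hopSymbol (x, y))⁻¹ :=
      hcont.comp (by fun_prop)
    calc x / (2 * x ^ 2 + m ^ 2) = ∫ _ in Set.Icc 0 x, (2 * x ^ 2 + m ^ 2)⁻¹ := by
          simp [hx.1, div_eq_mul_inv]
      _ ≤ ∫ y in Set.Icc 0 x, (4 + m ^ 2 - hopSymbol (x, y))⁻¹ := by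
          refine setIntegral_mono_on (by simp) (hcx.continuousOn.integrableOn_compact
            isCompact_Icc) measurableSet_Icc fun y hy => ?_
          refine inv_anti₀ (four_add_sq_sub_hopSymbol_pos hm _) ?_
          have h1 := Real.one_sub_sq_div_two_le_cos (x := x)
          have h2 := Real.one_sub_sq_div_two_le_cos (x := y)
          have h3 : y ^ 2 ≤ x ^ 2 := pow_le_pow_left₀ hy.1 hy.2 2
          simp only [hopSymbol]
          linarith
      _ ≤ _ := setIntegral_mono_set (hcx.continuousOn.integrableOn_compact isCompact_Icc)
          (Eventually.of_forall fun y => hnonneg (x, y))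
          (Set.Icc_subset_Icc (by linarith) hx.2).eventuallyLE
  have hprod : ∫ k in zone, (4 + m ^ 2 - hopSymbol k)⁻¹ =
      ∫ x in Set.Icc (-Real.pi) Real.pi, ∫ y in Set.Icc (-Real.pi) Real.pi,
        (4 + m ^ 2 - hopSymbol (x, y))⁻¹ := by
    rw [zone, Measure.volume_eq_prod] at *
    exact setIntegral_prod _ hi
  have hF : IntegrableOn (fun x => ∫ y in Set.Icc (-Real.pi) Real.pi,
      (4 + m ^ 2 - hopSymbol (x, y))⁻¹) (Set.Icc (-Real.pi) Real.pi) := by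
    rw [zone, IntegrableOn, Measure.volume_eq_prod, ← Measure.prod_restrict] at hi
    exact hi.integral_prod_left
  have hsub : Set.Icc 0 Real.pi ⊆ Set.Icc (-Real.pi) Real.pi :=
    Set.Icc_subset_Icc (by linarith) le_rfl
  calc 1 / 2 * Real.log (1 / m) + 1 / 4 * Real.log (2 * Real.pi ^ 2)
      ≤ 1 / 4 * (Real.log (2 * Real.pi ^ 2 + m ^ 2) - Real.log (m ^ 2)) := by
        have := Real.log_le_log (show 0 < 2 * Real.pi ^ 2 by positivity)
          (show 2 * Real.pi ^ 2 ≤ 2 * Real.pi ^ 2 + m ^ 2 by linarith [sq_nonneg m])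
        rw [one_div m, Real.log_inv, Real.log_pow]
        push_cast
        linarith
    _ = ∫ x in Set.Icc 0 Real.pi, x / (2 * x ^ 2 + m ^ 2) := by
        rw [← integral_div_two_mul_sq_add hm, intervalIntegral.integral_of_le hpi.le,
          integral_Icc_eq_integral_Ioc]
    _ ≤ ∫ x in Set.Icc 0 Real.pi, ∫ y in Set.Icc (-Real.pi) Real.pi,
          (4 + m ^ 2 - hopSymbol (x, y))⁻¹ :=
        setIntegral_mono_on
          ((continuous_id.div (by fun_prop) fun x => by positivity).continuousOn
            |>.integrableOn_compact isCompact_Icc)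
          (hF.mono_set hsub) measurableSet_Icc hinner
    _ ≤ _ := by
        rw [hprod]
        exact setIntegral_mono_set hF
          (Eventually.of_forall fun x => integral_nonneg fun y => hnonneg (x, y))
          hsub.eventuallyLE

/-- Logarithmic divergence of the diagonal: there are `K₁, K₂ > 0` such that
for every `m ∈ (0,1)`, every `L` and every site `j` of the torus,
`(C_m^Λ)_{jj} ≥ (C_m^∞)_{jj} ≥ K₁ ln(1/m) + K₂`. -/
theorem diagonal_log_divergence :
    ∃ K₁ K₂ : ℝ, 0 < K₁ ∧ 0 < K₂ ∧
      ∀ m : ℝ, 0 < m → m < 1 → ∀ (L : ℕ) [NeZero L], ∀ j : Site 2 L,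
        K₁ * Real.log (1 / m) + K₂ ≤ Cinf m (rep L j) (rep L j) ∧
        Cinf m (rep L j) (rep L j) ≤ CmLat L m j j := by
  have hpi := Real.pi_gt_three
  refine ⟨((2 * Real.pi) ^ 2)⁻¹ * (1 / 2), ((2 * Real.pi) ^ 2)⁻¹ *
    (1 / 4 * Real.log (2 * Real.pi ^ 2)), by positivity, ?_, fun m hm _ L _ j => ⟨?_, ?_⟩⟩
  · have : 0 < Real.log (2 * Real.pi ^ 2) := Real.log_pos (by nlinarith)
    positivity
  · rw [Cinf_self, mul_assoc, ← mul_add]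
    gcongr
    exact log_le_setIntegral_zone hm
  · exact Cinf_self_le_CmLat_self hm _ j

end
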